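/- Let ψ ∈ 𝓕, set ψ̄ := Υ(ψ), and define γ_i from ψ̄. Then γ_i ∘ φ_I = φ_i for every i = 0, 1, …, I, where φ_0(u) := u. In particular, γ_0 is the inverse of φ_I. -/

import Mathlib

open Set Filter

noncomputable section

/-- `f ∈ 𝒞`: continuous, non-decreasing, `ℝ₊`-valued on `ℝ₊`, with `f 0 = 0`. -/
def memC (f : ℝ → ℝ) : Prop :=
  ContinuousOn f (Ici 0) ∧ MonotoneOn f (Ici 0) ∧ f 0 = 0 ∧ ∀ u ∈ Ici (0:ℝ), 0 ≤ f u

/-- `f ∈ 𝒞^↑`: member of `𝒞` that is strictly increasing and tends to `∞` at `∞`. -/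
def memCup (f : ℝ → ℝ) : Prop :=
  memC f ∧ StrictMonoOn f (Ici 0) ∧ Tendsto f atTop atTop

/-- the soliton size associated with the index `i : Fin I`, namely `i+1`, as a real number. -/
def sz {I : ℕ} (i : Fin I) : ℝ := (i : ℕ) + 1

/-- the effective-distance (integrated slot density) function `φ_i`. -/
def phi {I : ℕ} (ψ : Fin I → ℝ → ℝ) (i : Fin I) (u : ℝ) : ℝ :=
  u - ∑ j, 2 * min (sz i) (sz j) * ψ j u

/-- the top effective-distance function `φ_I` (note `min (I, j) = j` for `j ≤ I`). -/
def phiTop {I : ℕ} (ψ : Fin I → ℝ → ℝ) (u : ℝ) : ℝ :=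
  u - ∑ j, 2 * sz j * ψ j u

/-- `ψ ∈ 𝓕`. -/
def memF {I : ℕ} (ψ : Fin I → ℝ → ℝ) : Prop :=
  (∀ i, memC (ψ i)) ∧ memCup (phiTop ψ)

/-- the inverse of `f : ℝ₊ → ℝ₊` (as a function `ℝ → ℝ` supported in domain `Ici 0`). -/
def rinv (f : ℝ → ℝ) : ℝ → ℝ := Function.invFunOn f (Ici 0)

/-- the effective scaling (scattering) map `Υ`. -/
def Upsilon {I : ℕ} (ψ : Fin I → ℝ → ℝ) : Fin I → ℝ → ℝ :=
  fun i => ψ i ∘ rinv (phi ψ i)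

/-- `gammaK ψb k = γ_{I-k}`, defined by downward recursion from `γ_I = id`:
`γ_i(z) = z + ∑_{j>i} 2(j-i) ψb_j (γ_j z)`. -/
def gammaK {I : ℕ} (ψb : Fin I → ℝ → ℝ) : ℕ → ℝ → ℝ
  | 0 => fun z => z
  | k + 1 => fun z =>
      z + ∑ m ∈ (Finset.range (k + 1)).attach,
        2 * (((k + 1 : ℕ) : ℝ) - ((m : ℕ) : ℝ)) *
          (if h : (m : ℕ) < I then
              ψb ⟨I - 1 - (m : ℕ), by omega⟩ (gammaK ψb (m : ℕ) z)
            else 0)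
  termination_by k => k
  decreasing_by have hm := Finset.mem_range.mp m.2; omega

/-- `γ_i`, for `i = 0, 1, …, I`. -/
def gam {I : ℕ} (ψb : Fin I → ℝ → ℝ) (i : ℕ) : ℝ → ℝ := gammaK ψb (I - i)

/-- the spatial reconstruction (inverse scattering) map `Γ`. -/
def Gamma {I : ℕ} (ψb : Fin I → ℝ → ℝ) : Fin I → ℝ → ℝ :=
  fun i => ψb i ∘ gam ψb ((i : ℕ) + 1) ∘ rinv (gam ψb 0)

/-- the free-evolution shift `θ_t`. -/
def theta {I : ℕ} (t : ℝ) (ψb : Fin I → ℝ → ℝ) : Fin I → ℝ → ℝ :=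
  fun i z => ψb i (max (z - sz i * t) 0)

/-- `ψ ∈ 𝒟`: member of `𝓕` satisfying the density condition
`∑_i i · sup_{u₁≠u₂} (ψ_i(u₁)-ψ_i(u₂))/(φ_i(u₁)-φ_i(u₂)) < 1/2`. -/
def memD {I : ℕ} (ψ : Fin I → ℝ → ℝ) : Prop :=
  memF ψ ∧
  ∃ c : Fin I → ℝ,
    (∀ i, ∀ u₁ ∈ Ici (0:ℝ), ∀ u₂ ∈ Ici (0:ℝ), u₂ < u₁ →
      ψ i u₁ - ψ i u₂ ≤ c i * (phi ψ i u₁ - phi ψ i u₂)) ∧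
    ∑ i, sz i * c i < 1 / 2

/-- `ψb ∈ 𝒟̄`: member of `𝒞^I` satisfying the density condition
`∑_i i · sup_{z₁≠z₂} (ψb_i(z₁)-ψb_i(z₂))/(z₁-z₂) < 1/2`. -/
def memDbar {I : ℕ} (ψb : Fin I → ℝ → ℝ) : Prop :=
  (∀ i, memC (ψb i)) ∧
  ∃ c : Fin I → ℝ,
    (∀ i, ∀ z₁ ∈ Ici (0:ℝ), ∀ z₂ ∈ Ici (0:ℝ), z₂ < z₁ →
      ψb i z₁ - ψb i z₂ ≤ c i * (z₁ - z₂)) ∧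
    ∑ i, sz i * c i < 1 / 2

/-- the extension `f^ℝ` of `f` to `ℝ`, by `0` on the negative half-line. -/
def extZ (f : ℝ → ℝ) : ℝ → ℝ := fun u => if 0 ≤ u then f u else 0

/-- the extension `f^{ℝ,↑}` of `f` to `ℝ`, by the identity on the negative half-line. -/
def extId (f : ℝ → ℝ) : ℝ → ℝ := fun u => if 0 ≤ u then f u else u

/-- `f ∈ 𝒞^q`. -/
def memCq (q : ℕ) (f : ℝ → ℝ) : Prop := memC f ∧ ContDiff ℝ q (extZ f)

/-- `f ∈ 𝒞^{↑,q}`. -/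
def memCupq (q : ℕ) (f : ℝ → ℝ) : Prop := memCup f ∧ ContDiff ℝ q (extId f)

/-- `f ∈ C^q(ℝ₊², ℝ₊)`: `ℝ₊`-valued and `q`-times continuously differentiable on the
quadrant (one-sided at the boundary). -/
def memCqTwo (q : ℕ) (f : ℝ → ℝ → ℝ) : Prop :=
  (∀ u ∈ Ici (0:ℝ), ∀ t ∈ Ici (0:ℝ), 0 ≤ f u t) ∧
  ContDiffOn ℝ q (fun p : ℝ × ℝ => f p.1 p.2) (Ici 0 ×ˢ Ici 0)

/-- the matrix `M(ρ)`. -/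
def Mmat {I : ℕ} (ρ : Fin I → ℝ) : Matrix (Fin I) (Fin I) ℝ :=
  Matrix.of fun i j =>
    if i = j then 1 - ∑ k ∈ Finset.univ.erase i, 2 * min (sz i) (sz k) * ρ k
    else 2 * min (sz i) (sz j) * ρ j

/-- the effective speeds `v^eff(ρ) = M(ρ)⁻¹ v`, where `v_i = i`. -/
def veff {I : ℕ} (ρ : Fin I → ℝ) : Fin I → ℝ :=
  ((Mmat ρ)⁻¹).mulVec fun i => sz i

/-- `ρ ∈ 𝒟_density`. -/
def memDdensity {I : ℕ} (ρ : Fin I → ℝ → ℝ) : Prop :=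
  (∀ i, (∀ u ∈ Ici (0:ℝ), 0 ≤ ρ i u) ∧ ContDiff ℝ 1 (extZ (ρ i))) ∧
  (∀ u ∈ Ici (0:ℝ), ∑ i, 2 * sz i * ρ i u < 1) ∧
  ∃ c : Fin I → ℝ,
    (∀ i, ∀ u ∈ Ici (0:ℝ),
      ρ i u ≤ c i * (1 - ∑ j, 2 * min (sz i) (sz j) * ρ j u)) ∧
    ∑ i, sz i * c i < 1 / 2

/-- The effective distance with a real truncation level `a` in place of the soliton size. -/
def phiLevel {I : ℕ} (ψ : Fin I → ℝ → ℝ) (a u : ℝ) : ℝ :=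
  u - ∑ j, 2 * min a (sz j) * ψ j u

lemma sz_le {I : ℕ} (j : Fin I) : sz j ≤ I := by
  unfold sz
  exact_mod_cast j.isLt

lemma phiLevel_top {I : ℕ} (ψ : Fin I → ℝ → ℝ) (u : ℝ) :
    phiLevel ψ I u = phiTop ψ u := by
  simp only [phiLevel, phiTop, min_eq_right (sz_le _)]

lemma phiLevel_zero {I : ℕ} (ψ : Fin I → ℝ → ℝ) (u : ℝ) : phiLevel ψ 0 u = u := by
  have h (j : Fin I) : min 0 (sz j) = 0 := min_eq_left (by unfold sz; positivity)
  simp [phiLevel, h]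

lemma phiLevel_eq_phiTop_add {I : ℕ} (ψ : Fin I → ℝ → ℝ) (a u : ℝ) :
    phiLevel ψ a u = phiTop ψ u + ∑ j, 2 * max (sz j - a) 0 * ψ j u := by
  rw [phiLevel, phiTop, sub_add, ← Finset.sum_sub_distrib]
  congr 1
  refine Finset.sum_congr rfl fun j _ => ?_
  rcases le_total a (sz j) with h | h
  · rw [min_eq_left h, max_eq_left (by linarith)]; ring
  · rw [min_eq_right h, max_eq_right (by linarith)]; ring

lemma strictMonoOn_phi {I : ℕ} {ψ : Fin I → ℝ → ℝ} (hψ : memF ψ) (i : Fin I) :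
    StrictMonoOn (phi ψ i) (Ici 0) := by
  intro x hx y hy hxy
  change phiLevel ψ (sz i) x < phiLevel ψ (sz i) y
  rw [phiLevel_eq_phiTop_add, phiLevel_eq_phiTop_add]
  refine add_lt_add_of_lt_of_le (hψ.2.2.1 hx hy hxy) (Finset.sum_le_sum fun j _ => ?_)
  exact mul_le_mul_of_nonneg_left ((hψ.1 j).2.1 hx hy hxy.le) (by positivity)

lemma Upsilon_phi {I : ℕ} {ψ : Fin I → ℝ → ℝ} (hψ : memF ψ) (i : Fin I) {u : ℝ}
    (hu : u ∈ Ici (0 : ℝ)) : Upsilon ψ i (phi ψ i u) = ψ i u :=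
  congrArg (ψ i) ((strictMonoOn_phi hψ i).injOn.leftInvOn_invFunOn hu)

/-- Summation over the sizes exceeding `I - k`, indexed by the distance to the largest size. -/
lemma sum_max_sub_eq_sum_range {I k : ℕ} (hk : k ≤ I) (f : Fin I → ℝ) :
    ∑ j, 2 * max (sz j - ((I - k : ℕ) : ℝ)) 0 * f j =
      ∑ m ∈ Finset.range k,
        2 * ((k : ℝ) - m) * (if h : m < I then f ⟨I - 1 - m, by omega⟩ else 0) := by
  rw [← Equiv.sum_comp Fin.revPerm]
  have hsub : Finset.range k ⊆ Finset.range I := Finset.range_mono hk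
  have hterm : ∀ j : Fin I,
      2 * max (sz (Fin.revPerm j) - ((I - k : ℕ) : ℝ)) 0 * f (Fin.revPerm j) =
      2 * max ((k : ℝ) - (j : ℕ)) 0 *
        (if h : (j : ℕ) < I then f ⟨I - 1 - j, by omega⟩ else 0) := by
    intro j
    have hj := j.isLt
    have hrev : Fin.revPerm j = ⟨I - 1 - j, by omega⟩ := by
      ext
      simp only [Fin.revPerm_apply, Fin.val_rev]
      omega
    rw [hrev, dif_pos hj]
    congr 3
    have h : ((I - 1 - (j : ℕ) : ℕ) : ℝ) + 1 + (j : ℕ) = I := by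
      exact_mod_cast (by omega : I - 1 - (j : ℕ) + 1 + j = I)
    simp only [sz, Nat.cast_sub hk]
    linarith
  rw [Finset.sum_congr rfl fun j _ => hterm j,
    Fin.sum_univ_eq_sum_range (fun m : ℕ => 2 * max ((k : ℝ) - m) 0 *
      (if h : m < I then f ⟨I - 1 - m, by omega⟩ else 0)) I]
  rw [← Finset.sum_subset hsub]
  · refine Finset.sum_congr rfl fun m hm => ?_
    have : (m : ℝ) ≤ k := by exact_mod_cast (Finset.mem_range.mp hm).le
    rw [max_eq_left (by linarith)]
  · intro m _ hm
    have : (k : ℝ) ≤ m := by exact_mod_cast not_lt.mp (mt Finset.mem_range.mpr hm)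
    rw [max_eq_right (by linarith)]
    ring

lemma gammaK_Upsilon_phiTop {I : ℕ} {ψ : Fin I → ℝ → ℝ} (hψ : memF ψ) {u : ℝ}
    (hu : u ∈ Ici (0 : ℝ)) (k : ℕ) (hk : k ≤ I) :
    gammaK (Upsilon ψ) k (phiTop ψ u) = phiLevel ψ ((I - k : ℕ) : ℝ) u := by
  induction k using Nat.strong_induction_on with
  | _ k ih =>
    cases k with
    | zero => rw [gammaK, Nat.sub_zero, phiLevel_top]
    | succ k =>
      rw [gammaK, phiLevel_eq_phiTop_add, sum_max_sub_eq_sum_range hk]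
      refine congrArg (phiTop ψ u + ·)
        ((Finset.sum_congr rfl fun m _ => ?_).trans (Finset.sum_attach _ _))
      have hm := Finset.mem_range.mp m.2
      have hmI : (m : ℕ) < I := by omega
      rw [dif_pos hmI, dif_pos hmI, ih m hm hmI.le]
      have hlevel : ((I - (m : ℕ) : ℕ) : ℝ) = sz (⟨I - 1 - m, by omega⟩ : Fin I) := by
        simp only [sz]
        exact_mod_cast (by omega : I - (m : ℕ) = I - 1 - m + 1)
      rw [hlevel]
      exact congrArg _ (Upsilon_phi hψ _ hu)

lemma memCup.surjOn {f : ℝ → ℝ} (hf : memCup f) : SurjOn f (Ici 0) (Ici 0) := by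
  intro z hz
  obtain ⟨b, hb, hzb⟩ := ((eventually_ge_atTop (0 : ℝ)).and
    (hf.2.2.eventually_ge_atTop z)).exists
  obtain ⟨u, hu, rfl⟩ := intermediate_value_Icc hb (hf.1.1.mono Icc_subset_Ici_self)
    ⟨hf.1.2.2.1.trans_le hz, hzb⟩
  exact ⟨u, hu.1, rfl⟩

/-- for `ψ ∈ 𝓕` and `γ` defined from `ψ̄ := Υ(ψ)`, one has
`γ_i ∘ φ_I = φ_i` for `i = 0, 1, …, I` (with `φ_0 = id`); in particular `γ_0` is the
(two-sided) inverse of `φ_I` on `ℝ₊`. -/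
theorem stmt_4 {I : ℕ} (hI : 1 ≤ I) (ψ : Fin I → ℝ → ℝ) (hψ : memF ψ) :
    (∀ i : ℕ, ∀ hi : i ≤ I, ∀ u ∈ Ici (0:ℝ),
        gam (Upsilon ψ) i (phiTop ψ u) =
          if h : i = 0 then u else phi ψ ⟨i - 1, by omega⟩ u) ∧
    (∀ u ∈ Ici (0:ℝ), gam (Upsilon ψ) 0 (phiTop ψ u) = u) ∧
    (∀ z ∈ Ici (0:ℝ), phiTop ψ (gam (Upsilon ψ) 0 z) = z) := by
  have level (i : ℕ) (hi : i ≤ I) {u : ℝ} (hu : u ∈ Ici (0 : ℝ)) :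
      gam (Upsilon ψ) i (phiTop ψ u) = phiLevel ψ i u := by
    rw [gam, gammaK_Upsilon_phiTop hψ hu _ (Nat.sub_le _ _), Nat.sub_sub_self hi]
  have inv : ∀ u ∈ Ici (0:ℝ), gam (Upsilon ψ) 0 (phiTop ψ u) = u := fun u hu => by
    rw [level 0 (Nat.zero_le _) hu, Nat.cast_zero, phiLevel_zero]
  refine ⟨fun i hi u hu => ?_, inv, fun z hz => ?_⟩
  · split_ifs with h
    · subst h
      exact inv u hu
    · rw [level i hi hu]
      have hsz : (i : ℝ) = sz (⟨i - 1, by omega⟩ : Fin I) := by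
        simp only [sz]
        exact_mod_cast (by omega : i = i - 1 + 1)
      rw [hsz]
      rfl
  · obtain ⟨u, hu, rfl⟩ := hψ.2.surjOn hz
    rw [inv u hu]
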